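/- The constructible region Ψ₄ = { π ∈ ℝ^{2⁴−1} : π is the vector of logarithms of projection volumes of some compact set T ⊆ ℝ⁴ with all projection volumes positive } is not a convex subset of ℝ^{15}. -/

import Mathlib

open MeasureTheory

/-- The `|S|`-dimensional Lebesgue volume of the orthogonal projection of `T ⊆ ℝⁿ`
onto the coordinate subspace indexed by `S`. -/
noncomputable def projVol {n : ℕ} (T : Set (Fin n → ℝ)) (S : Finset (Fin n)) : ℝ :=
  (volume ((fun (x : Fin n → ℝ) (i : S) => x i.1) '' T)).toReal

section Auxiliary

open Set

/-- The points of `X` over which the fibre of `P` contains almost all of `Z`. -/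
def fullFibers {α β : Type*} [MeasurableSpace β] (ν : Measure β)
    (X : Set α) (Z : Set β) (P : Set (α × β)) : Set α :=
  {x ∈ X | ν (Z \ Prod.mk x ⁻¹' P) = 0}

section FullFibers

variable {α β : Type*} [MeasurableSpace α] [MeasurableSpace β]

lemma measurableSet_fullFibers {ν : Measure β} [SFinite ν] {X : Set α} {Z : Set β}
    {P : Set (α × β)} (hX : MeasurableSet X) (hZ : MeasurableSet Z) (hP : MeasurableSet P) :
    MeasurableSet (fullFibers ν X Z P) := by
  have h : Measurable fun x => ν (Prod.mk x ⁻¹' ((univ ×ˢ Z) \ P)) :=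
    measurable_measure_prodMk_left ((MeasurableSet.univ.prod hZ).diff hP)
  have h' : Measurable fun x => ν (Z \ Prod.mk x ⁻¹' P) := by
    convert h using 4 with x
    ext z; simp
  exact hX.inter (h' (measurableSet_singleton 0))

lemma ae_mem_of_mem_fullFibers {μ : Measure α} {ν : Measure β} [SFinite ν]
    {X : Set α} {Z : Set β} {P : Set (α × β)}
    (hX : MeasurableSet X) (hZ : MeasurableSet Z) (hP : MeasurableSet P) :
    ∀ᵐ w ∂μ.prod ν, w.1 ∈ fullFibers ν X Z P → w.2 ∈ Z → w ∈ P := by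
  have hm := measurableSet_fullFibers (ν := ν) hX hZ hP
  have hs : MeasurableSet ((fullFibers ν X Z P ×ˢ Z) \ P) := (hm.prod hZ).diff hP
  have h0 : μ.prod ν ((fullFibers ν X Z P ×ˢ Z) \ P) = 0 := by
    rw [Measure.measure_prod_null hs]
    refine Filter.Eventually.of_forall fun x => ?_
    by_cases hx : x ∈ fullFibers ν X Z P
    · refine measure_mono_null ?_ hx.2
      rintro z ⟨⟨-, hz⟩, hzP⟩
      exact ⟨hz, hzP⟩
    · refine measure_mono_null (t := ∅) ?_ measure_empty
      rintro z ⟨⟨hz, -⟩, -⟩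
      exact hx hz
  filter_upwards [measure_eq_zero_iff_ae_notMem.1 h0] with w hw h1 h2
  by_contra h3
  exact hw ⟨⟨h1, h2⟩, h3⟩

/-- The part of a rectangle outside `P` avoids the full fibres in both directions. -/
lemma measureReal_prod_le_add_fullFibers {μ : Measure α} {ν : Measure β} [SigmaFinite μ]
    [SigmaFinite ν] {X : Set α} {Z : Set β} {P : Set (α × β)}
    (hX : MeasurableSet X) (hZ : MeasurableSet Z) (hP : MeasurableSet P)
    (hXf : μ X ≠ ⊤) (hZf : ν Z ≠ ⊤) (hPf : μ.prod ν P ≠ ⊤) :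
    μ.real X * ν.real Z ≤ (μ.prod ν).real P +
      (μ.real X - μ.real (fullFibers ν X Z P)) *
        (ν.real Z - ν.real (fullFibers μ Z X (Prod.swap ⁻¹' P))) := by
  have hP' : MeasurableSet (Prod.swap ⁻¹' P : Set (β × α)) := measurable_swap hP
  have hm := measurableSet_fullFibers (ν := ν) hX hZ hP
  have hm' := measurableSet_fullFibers (ν := μ) hZ hX hP'
  have hsub : fullFibers ν X Z P ⊆ X := fun x hx => hx.1
  have hsub' : fullFibers μ Z X (Prod.swap ⁻¹' P) ⊆ Z := fun x hx => hx.1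
  rw [← measureReal_sdiff hsub hm hXf,
    ← measureReal_sdiff hsub' hm' hZf,
    ← measureReal_prod_prod, ← measureReal_prod_prod]
  have hf : μ.prod ν ((X \ fullFibers ν X Z P) ×ˢ
      (Z \ fullFibers μ Z X (Prod.swap ⁻¹' P))) ≠ ⊤ := by
    rw [Measure.prod_prod]
    exact ENNReal.mul_ne_top (measure_ne_top_of_subset sdiff_subset hXf)
      (measure_ne_top_of_subset sdiff_subset hZf)
  refine le_trans ?_ (measureReal_union_le _ _)
  refine ENNReal.toReal_mono (measure_union_ne_top hPf hf) (measure_mono_ae ?_)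
  have h2 : ∀ᵐ w ∂μ.prod ν, w.2 ∈ fullFibers μ Z X (Prod.swap ⁻¹' P) → w.1 ∈ X → w ∈ P :=
    (Measure.measurePreserving_swap (μ := μ) (ν := ν)).quasiMeasurePreserving.ae
      (ae_mem_of_mem_fullFibers hZ hX hP')
  filter_upwards [ae_mem_of_mem_fullFibers (μ := μ) (ν := ν) hX hZ hP, h2] with w h1 h2
  rintro ⟨hx, hz⟩
  by_cases hw : w ∈ P
  · exact Or.inl hw
  · exact Or.inr ⟨⟨hx, fun h => hw (h1 h hz)⟩, ⟨hz, fun h => hw (h2 h hx)⟩⟩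

end FullFibers

section Projections

variable {n : ℕ}

/-- The image of `T` under the pair of coordinate projections onto `A` and `B`. -/
def pairProj (T : Set (Fin n → ℝ)) (A B : Finset (Fin n)) : Set ((A → ℝ) × (B → ℝ)) :=
  (fun x => (A.restrict x, B.restrict x)) '' T

lemma isCompact_restrict_image {T : Set (Fin n → ℝ)} (hT : IsCompact T) (A : Finset (Fin n)) :
    IsCompact (A.restrict '' T) :=
  hT.image (by fun_prop)

lemma isCompact_pairProj {T : Set (Fin n → ℝ)} (hT : IsCompact T) (A B : Finset (Fin n)) :
    IsCompact (pairProj T A B) :=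
  hT.image (by fun_prop)

lemma projVol_eq_measureReal (T : Set (Fin n → ℝ)) (S : Finset (Fin n)) :
    projVol T S = volume.real (S.restrict '' T) := rfl

lemma piFinsetUnion_restrict {A B : Finset (Fin n)} (h : Disjoint A B) (x : Fin n → ℝ) :
    MeasurableEquiv.piFinsetUnion (fun _ => ℝ) h (A.restrict x, B.restrict x) =
      (A ∪ B).restrict x := by
  ext ⟨i, hi⟩
  rcases Finset.mem_union.1 hi with hA | hB
  · exact Equiv.piFinsetUnion_left (fun _ => ℝ) h hA hi
  · exact Equiv.piFinsetUnion_right (fun _ => ℝ) h hB hi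

lemma projVol_union {A B : Finset (Fin n)} (h : Disjoint A B) (T : Set (Fin n → ℝ)) :
    projVol T (A ∪ B) = volume.real (pairProj T A B) := by
  have himg : (A ∪ B).restrict '' T =
      MeasurableEquiv.piFinsetUnion (fun _ => ℝ) h '' pairProj T A B := by
    rw [pairProj, image_image]
    exact image_congr fun x _ => (piFinsetUnion_restrict h x).symm
  rw [projVol_eq_measureReal, himg, MeasurableEquiv.image_eq_preimage_symm, measureReal_def,
    (volume_preserving_piFinsetUnion (fun _ => ℝ) h).symm.measure_preimage_equiv,
    measureReal_def]

/-- If `T_{A ∪ B ∪ C}` is as large as `T_{A ∪ B} × T_C`, then almost every point of `T_{A ∪ B}`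
lies over a full fibre of `T_{A ∪ C}`. -/
lemma projVol_union_le_of_tight {T : Set (Fin n → ℝ)} (hT : IsCompact T)
    {A B C : Finset (Fin n)} (hAB : Disjoint A B) (hABC : Disjoint (A ∪ B) C)
    (h : projVol T (A ∪ B ∪ C) = projVol T (A ∪ B) * projVol T C) :
    projVol T (A ∪ B) ≤
      volume.real (fullFibers volume (A.restrict '' T) (C.restrict '' T) (pairProj T A C)) *
        projVol T B := by
  set F := fullFibers volume (A.restrict '' T) (C.restrict '' T) (pairProj T A C)
  have hK := isCompact_restrict_image hT
  have hsub : pairProj T (A ∪ B) C ⊆ ((A ∪ B).restrict '' T) ×ˢ (C.restrict '' T) := by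
    rintro _ ⟨x, hx, rfl⟩
    exact ⟨mem_image_of_mem _ hx, mem_image_of_mem _ hx⟩
  have hnull : (volume : Measure (((A ∪ B : Finset (Fin n)) → ℝ) × (C → ℝ)))
      ((((A ∪ B).restrict '' T) ×ˢ (C.restrict '' T)) \ pairProj T (A ∪ B) C) = 0 := by
    rw [← measureReal_eq_zero_iff
      (measure_ne_top_of_subset sdiff_subset ((hK _).prod (hK _)).measure_ne_top),
      measureReal_sdiff hsub (isCompact_pairProj hT _ _).measurableSet
        ((hK _).prod (hK _)).measure_ne_top, Measure.volume_eq_prod,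
      measureReal_prod_prod, ← Measure.volume_eq_prod, ← projVol_union hABC, h]
    exact sub_self _
  have hae := Measure.ae_ae_of_ae_prod (measure_eq_zero_iff_ae_notMem.1 hnull)
  set e := MeasurableEquiv.piFinsetUnion (fun _ : Fin n => ℝ) hAB
  have hvol : volume.real (e.symm ⁻¹' (F ×ˢ (B.restrict '' T))) =
      volume.real F * projVol T B := by
    rw [measureReal_def,
      (volume_preserving_piFinsetUnion (fun _ => ℝ) hAB).symm.measure_preimage_equiv,
      ← measureReal_def, Measure.volume_eq_prod, measureReal_prod_prod]
    rfl
  rw [← hvol]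
  refine ENNReal.toReal_mono ?_ (measure_mono_ae ?_)
  · rw [(volume_preserving_piFinsetUnion (fun _ => ℝ) hAB).symm.measure_preimage_equiv]
    refine measure_ne_top_of_subset (prod_mono_left fun x hx => hx.1)
      ((hK A).prod (hK B)).measure_ne_top
  · filter_upwards [hae] with w hw
    rintro ⟨x, hx, rfl⟩
    have hx' : e.symm ((A ∪ B).restrict x) = (A.restrict x, B.restrict x) := by
      rw [← piFinsetUnion_restrict hAB, MeasurableEquiv.symm_apply_apply]
    change e.symm ((A ∪ B).restrict x) ∈ F ×ˢ (B.restrict '' T)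
    rw [hx']
    refine ⟨⟨mem_image_of_mem _ hx, ?_⟩, mem_image_of_mem _ hx⟩
    rw [measure_eq_zero_iff_ae_notMem]
    filter_upwards [hw] with z hz
    rintro ⟨hzC, hzP⟩
    apply hz
    refine ⟨⟨mem_image_of_mem _ hx, hzC⟩, ?_⟩
    rintro ⟨y, hy, hyz⟩
    refine hzP ⟨y, hy, ?_⟩
    have h1 := congrArg Prod.fst hyz
    have h2 := congrArg Prod.snd hyz
    refine Prod.ext ?_ h2
    ext i
    exact congrFun h1 ⟨i.1, Finset.mem_union_left _ i.2⟩

/-- Two tight three-block projections sharing the blocks `A` and `C` force `T_{A ∪ C}` to be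
large. -/
lemma le_projVol_union_of_tight {T : Set (Fin n → ℝ)} (hT : IsCompact T)
    {A B C D : Finset (Fin n)} (hAB : Disjoint A B) (hABC : Disjoint (A ∪ B) C)
    (hCD : Disjoint C D) (hCDA : Disjoint (C ∪ D) A)
    (h : projVol T (A ∪ B ∪ C) = projVol T (A ∪ B) * projVol T C)
    (h' : projVol T (C ∪ D ∪ A) = projVol T (C ∪ D) * projVol T A)
    {a c : ℝ} (ha : a * projVol T B ≤ projVol T (A ∪ B)) (hB : 0 < projVol T B)
    (hc : c * projVol T D ≤ projVol T (C ∪ D)) (hD : 0 < projVol T D)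
    (haA : a ≤ projVol T A) :
    projVol T A * projVol T C ≤ projVol T (A ∪ C) +
      (projVol T A - a) * (projVol T C - c) := by
  have hK := isCompact_restrict_image hT
  have hP := isCompact_pairProj hT A C
  have hAC : Disjoint A C := (Finset.disjoint_union_left.1 hABC).1
  have h1 := le_of_mul_le_mul_right (ha.trans (projVol_union_le_of_tight hT hAB hABC h)) hB
  have h2 := le_of_mul_le_mul_right (hc.trans (projVol_union_le_of_tight hT hCD hCDA h')) hD
  have hswap : pairProj T C A = Prod.swap ⁻¹' pairProj T A C := by
    rw [← image_swap_eq_preimage_swap, pairProj, pairProj, image_image]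
    rfl
  rw [hswap] at h2
  have h3 := measureReal_prod_le_add_fullFibers (μ := volume) (ν := volume)
    (hK A).measurableSet (hK C).measurableSet hP.measurableSet (hK A).measure_ne_top
    (hK C).measure_ne_top hP.measure_ne_top
  rw [← Measure.volume_eq_prod, ← projVol_union hAC, ← projVol_eq_measureReal,
    ← projVol_eq_measureReal] at h3
  refine h3.trans (add_le_add_right ?_ _)
  refine mul_le_mul (by linarith) (by linarith) ?_ (by linarith)
  refine sub_nonneg.2 (measureReal_mono (fun z hz => hz.1) (hK C).measure_ne_top)

lemma restrict_image_Icc {c : Fin n → ℝ} (hc : 0 ≤ c) (S : Finset (Fin n)) :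
    S.restrict '' Icc 0 c = Icc 0 (S.restrict c) := by
  ext y
  constructor
  · rintro ⟨x, hx, rfl⟩
    exact ⟨fun i => hx.1 i, fun i => hx.2 i⟩
  · intro hy
    refine ⟨fun i => if h : i ∈ S then y ⟨i, h⟩ else 0, ⟨fun i => ?_, fun i => ?_⟩, ?_⟩
    · by_cases h : i ∈ S
      · simpa [h] using hy.1 ⟨i, h⟩
      · simp [h]
    · by_cases h : i ∈ S
      · simpa [h] using hy.2 ⟨i, h⟩
      · simpa [h] using hc i
    · ext i
      simp

lemma projVol_Icc {c : Fin n → ℝ} (hc : 0 ≤ c) (S : Finset (Fin n)) :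
    projVol (Icc 0 c) S = ∏ i ∈ S, c i := by
  have h : (0 : S → ℝ) ≤ S.restrict c := fun i => hc i
  rw [projVol_eq_measureReal, restrict_image_Icc hc, measureReal_def,
    Real.volume_Icc_pi_toReal h]
  simpa using Finset.prod_coe_sort S c

lemma projVol_mono {T U : Set (Fin n → ℝ)} (hU : IsCompact U) (h : T ⊆ U)
    (S : Finset (Fin n)) : projVol T S ≤ projVol U S :=
  measureReal_mono (image_mono h) (isCompact_restrict_image hU S).measure_ne_top

lemma projVol_union_le (T U : Set (Fin n → ℝ)) (S : Finset (Fin n)) :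
    projVol (T ∪ U) S ≤ projVol T S + projVol U S := by
  simp only [projVol_eq_measureReal, image_union]
  exact measureReal_union_le _ _

lemma prod_le_projVol_of_Icc_subset {T : Set (Fin n → ℝ)} (hT : IsCompact T) {c : Fin n → ℝ}
    (hc : 0 ≤ c) (h : Icc 0 c ⊆ T) (S : Finset (Fin n)) : ∏ i ∈ S, c i ≤ projVol T S :=
  (projVol_Icc hc S).symm.trans_le (projVol_mono hT h S)

lemma projVol_Icc_union_le {c d e : Fin n → ℝ} (hc : 0 ≤ c) (hd : 0 ≤ d) (he : 0 ≤ e)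
    {S : Finset (Fin n)} (h : ∀ i ∈ S, e i ≤ c i) :
    projVol (Icc 0 c ∪ Icc 0 d ∪ Icc 0 e) S ≤ ∏ i ∈ S, c i + ∏ i ∈ S, d i := by
  have hsub : S.restrict '' Icc 0 e ⊆ S.restrict '' Icc 0 c := by
    rw [restrict_image_Icc hc, restrict_image_Icc he]
    exact Icc_subset_Icc_right fun i => h i i.2
  have heq : projVol (Icc 0 c ∪ Icc 0 d ∪ Icc 0 e) S = projVol (Icc 0 c ∪ Icc 0 d) S := by
    simp only [projVol_eq_measureReal, image_union]
    rw [union_eq_left.2 (hsub.trans subset_union_left)]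
  rw [heq, ← projVol_Icc hc, ← projVol_Icc hd]
  exact projVol_union_le _ _ _

end Projections

section Witness

/-- A union of three boxes whose projection onto the first and third coordinates is an L-shape. -/
def lShape : Set (Fin 4 → ℝ) :=
  Icc 0 ![1/4, 1, 1, 0] ∪ Icc 0 ![1, 0, 1/4, 1] ∪ Icc 0 ![1/4, 1, 1/4, 1]

lemma isCompact_lShape : IsCompact lShape :=
  (isCompact_Icc.union isCompact_Icc).union isCompact_Icc

lemma box_nonneg {a b c d : ℝ} (ha : 0 ≤ a) (hb : 0 ≤ b) (hc : 0 ≤ c) (hd : 0 ≤ d) :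
    0 ≤ ![a, b, c, d] := by
  intro i
  fin_cases i <;> simpa

lemma prod_le_projVol_lShape (S : Finset (Fin 4)) :
    ∏ i ∈ S, ![1/4, 1, 1, 0] i ≤ projVol lShape S ∧
      ∏ i ∈ S, ![1, 0, 1/4, 1] i ≤ projVol lShape S ∧
      ∏ i ∈ S, ![1/4, 1, 1/4, 1] i ≤ projVol lShape S := by
  refine ⟨prod_le_projVol_of_Icc_subset isCompact_lShape (by apply box_nonneg <;> norm_num) ?_ S,
    prod_le_projVol_of_Icc_subset isCompact_lShape (by apply box_nonneg <;> norm_num) ?_ S,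
    prod_le_projVol_of_Icc_subset isCompact_lShape (by apply box_nonneg <;> norm_num) ?_ S⟩
  · exact subset_union_left.trans subset_union_left
  · exact subset_union_right.trans subset_union_left
  · exact subset_union_right

lemma projVol_lShape_pos (S : Finset (Fin 4)) : 0 < projVol lShape S := by
  refine lt_of_lt_of_le (Finset.prod_pos fun i _ => ?_) (prod_le_projVol_lShape S).2.2
  fin_cases i <;> norm_num

lemma projVol_lShape_le {S : Finset (Fin 4)} (hS : 3 ∉ S ∨ 1 ∉ S) :
    projVol lShape S ≤
      ∏ i ∈ S, ![1/4, 1, 1, 0] i + ∏ i ∈ S, ![1, 0, 1/4, 1] i := by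
  have h1 : (0 : Fin 4 → ℝ) ≤ ![1/4, 1, 1, 0] := by apply box_nonneg <;> norm_num
  have h2 : (0 : Fin 4 → ℝ) ≤ ![1, 0, 1/4, 1] := by apply box_nonneg <;> norm_num
  have h3 : (0 : Fin 4 → ℝ) ≤ ![1/4, 1, 1/4, 1] := by apply box_nonneg <;> norm_num
  rcases hS with hS | hS
  · refine projVol_Icc_union_le h1 h2 h3 fun i hi => ?_
    fin_cases i <;> first | exact absurd hi hS | norm_num
  · rw [lShape, union_comm (Icc 0 _) (Icc 0 _), add_comm]
    refine projVol_Icc_union_le h2 h1 h3 fun i hi => ?_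
    fin_cases i <;> first | exact absurd hi hS | norm_num

lemma projVol_lShape_singleton (i : Fin 4) : projVol lShape {i} = 1 := by
  have hcube : lShape ⊆ Icc 0 1 := by
    rintro x ((⟨h0, h1⟩ | ⟨h0, h1⟩) | ⟨h0, h1⟩) <;>
    · refine ⟨h0, h1.trans fun j => ?_⟩
      fin_cases j <;> norm_num
  have hu : projVol lShape {i} ≤ 1 := by
    simpa [projVol_Icc zero_le_one] using projVol_mono isCompact_Icc hcube {i}
  refine hu.antisymm ?_
  obtain ⟨h1, h2, -⟩ := prod_le_projVol_lShape {i}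
  rw [Finset.prod_singleton] at h1 h2
  fin_cases i
  exacts [h2, h1, h1, h2]

lemma prod_finset_fin_four (S : Finset (Fin 4)) (a b c d : ℝ) :
    ∏ i ∈ S, ![a, b, c, d] i = (if 0 ∈ S then a else 1) * (if 1 ∈ S then b else 1) *
      (if 2 ∈ S then c else 1) * (if 3 ∈ S then d else 1) := by
  have h := Fin.prod_univ_four fun i => if i ∈ S then ![a, b, c, d] i else 1
  rwa [Finset.prod_ite_mem, Finset.univ_inter] at h

end Witness

end Auxiliary

/-- The constructible region Ψ₄ is not convex. -/
theorem stmt_4 :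
    ¬ Convex ℝ {π : {S : Finset (Fin 4) // S.Nonempty} → ℝ |
      ∃ T : Set (Fin 4 → ℝ), IsCompact T ∧
        (∀ S : {S : Finset (Fin 4) // S.Nonempty}, 0 < projVol T S.1) ∧
        (∀ S : {S : Finset (Fin 4) // S.Nonempty}, π S = Real.log (projVol T S.1))} := by
  intro hconv
  have hcube : ∀ S : Finset (Fin 4), projVol (Set.Icc 0 1) S = 1 := fun S => by
    simp [projVol_Icc zero_le_one]
  obtain ⟨T, hT, hpos, hlog⟩ := hconv
    (x := fun S => Real.log (projVol (Set.Icc 0 1) S.1))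
    ⟨Set.Icc 0 1, isCompact_Icc, fun S => by rw [hcube]; exact one_pos, fun S => rfl⟩
    (y := fun S => Real.log (projVol lShape S.1))
    ⟨lShape, isCompact_lShape, fun S => projVol_lShape_pos S.1, fun S => rfl⟩
    (a := 1/2) (b := 1/2) (by norm_num) (by norm_num) (by norm_num)
  have hsq : ∀ S : Finset (Fin 4), S.Nonempty → projVol T S ^ 2 = projVol lShape S := by
    intro S hS
    have h := hlog ⟨S, hS⟩
    simp only [hcube, Real.log_one, Pi.add_apply, Pi.smul_apply, smul_eq_mul] at h
    refine Real.log_injOn_pos (pow_pos (hpos ⟨S, hS⟩) 2) (projVol_lShape_pos S) ?_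
    rw [Real.log_pow]
    push_cast
    linarith
  have hval : ∀ {S : Finset (Fin 4)} {r : ℝ}, S.Nonempty → 0 ≤ r →
      projVol lShape S = r ^ 2 → projVol T S = r := fun {S r} hS hr h =>
    (pow_left_inj₀ (hpos ⟨S, hS⟩).le hr two_ne_zero).1 ((hsq S hS).trans h)
  have hsing : ∀ i, projVol T {i} = 1 := fun i =>
    hval (Finset.singleton_nonempty i) zero_le_one (by rw [projVol_lShape_singleton, one_pow])
  have hhalf : ∀ {S : Finset (Fin 4)}, S.Nonempty → (3 ∉ S ∨ 1 ∉ S) →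
      ∏ i ∈ S, ![1/4, 1, 1, 0] i + ∏ i ∈ S, ![1, 0, 1/4, 1] i = (1 / 2 : ℝ) ^ 2 →
      ∏ i ∈ S, ![1/4, 1, 1, 0] i = (1 / 2 : ℝ) ^ 2 ∨
        ∏ i ∈ S, ![1, 0, 1/4, 1] i = (1 / 2 : ℝ) ^ 2 →
      projVol T S = 1 / 2 := by
    intro S hS hS' hsum hor
    refine hval hS (by norm_num) (le_antisymm ((projVol_lShape_le hS').trans hsum.le) ?_)
    rcases hor with h | h
    · exact h.symm.trans_le (prod_le_projVol_lShape S).1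
    · exact h.symm.trans_le (prod_le_projVol_lShape S).2.1
  have h01 : projVol T ({0} ∪ {1}) = 1 / 2 :=
    hhalf (by decide) (by decide) (by simp only [prod_finset_fin_four]; norm_num [Fin.ext_iff])
      (by simp only [prod_finset_fin_four]; norm_num [Fin.ext_iff])
  have h012 : projVol T ({0} ∪ {1} ∪ {2}) = 1 / 2 :=
    hhalf (by decide) (by decide) (by simp only [prod_finset_fin_four]; norm_num [Fin.ext_iff])
      (by simp only [prod_finset_fin_four]; norm_num [Fin.ext_iff])
  have h23 : projVol T ({2} ∪ {3}) = 1 / 2 :=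
    hhalf (by decide) (by decide) (by simp only [prod_finset_fin_four]; norm_num [Fin.ext_iff])
      (by simp only [prod_finset_fin_four]; norm_num [Fin.ext_iff])
  have h230 : projVol T ({2} ∪ {3} ∪ {0}) = 1 / 2 :=
    hhalf (by decide) (by decide) (by simp only [prod_finset_fin_four]; norm_num [Fin.ext_iff])
      (by simp only [prod_finset_fin_four]; norm_num [Fin.ext_iff])
  have h02 : projVol T ({0} ∪ {2}) ^ 2 ≤ 1 / 2 := by
    rw [hsq _ (by decide)]
    refine (projVol_lShape_le (by decide)).trans (le_of_eq ?_)
    simp only [prod_finset_fin_four]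
    norm_num [Fin.ext_iff]
  have key := le_projVol_union_of_tight hT (A := {0}) (B := {1}) (C := {2}) (D := {3})
    (by decide) (by decide) (by decide) (by decide) (by rw [h012, h01, hsing, mul_one])
    (by rw [h230, h23, hsing, mul_one]) (a := 1/2) (c := 1/2)
    (by rw [h01, hsing, mul_one]) (by rw [hsing]; exact one_pos)
    (by rw [h23, hsing, mul_one]) (by rw [hsing]; exact one_pos)
    (by rw [hsing]; norm_num)
  rw [hsing, hsing] at key
  nlinarith
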